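/- arXiv:1504.03839 — 2 statements merged into one kernel-verified Lean document; each statement's English description precedes it below -/
import Mathlib

section
/- Let k be an even integer with k ≥ 2, and let H be a k-uniform hypergraph in which every vertex is contained in at least one edge. Then there exists a signless Laplacian H-eigenvalue λ of H with λ < δ(H), where δ(H) is the minimum vertex degree of H. -/
open Finset

section SignlessLaplacianForm

variable {V : Type*} [Fintype V]

/-- The degree `k` form `∑ v, c v * x v ^ k + k * ∑ e ∈ E, ∏ w ∈ e, x w`; for `c` the degree
function it is the signless Laplacian form of the hypergraph with edge set `E`. -/
noncomputable def edgeForm (E : Finset (Finset V)) (k : ℕ) (c x : V → ℝ) : ℝ :=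
  ∑ v, c v * x v ^ k + k * ∑ e ∈ E, ∏ w ∈ e, x w

lemma edgeForm_smul {E : Finset (Finset V)} {k : ℕ} (hunif : ∀ e ∈ E, e.card = k)
    (c x : V → ℝ) (s : ℝ) : edgeForm E k c (s • x) = s ^ k * edgeForm E k c x := by
  have hpow : ∑ v, c v * (s • x) v ^ k = s ^ k * ∑ v, c v * x v ^ k := by
    simp [Finset.mul_sum, mul_pow, mul_left_comm]
  have hedge : ∑ e ∈ E, ∏ w ∈ e, (s • x) w = s ^ k * ∑ e ∈ E, ∏ w ∈ e, x w := by
    rw [Finset.mul_sum]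
    refine Finset.sum_congr rfl fun e he => ?_
    simp [Finset.prod_mul_distrib, hunif e he]
  rw [edgeForm, edgeForm, hpow, hedge]
  ring

lemma edgeForm_sub_const (E : Finset (Finset V)) (k : ℕ) (c x : V → ℝ) (a : ℝ) :
    edgeForm E k (fun v => c v - a) x = edgeForm E k c x - a * ∑ v, x v ^ k := by
  simp only [edgeForm, sub_mul, Finset.sum_sub_distrib, Finset.mul_sum]
  ring

lemma sum_pow_pos_of_ne_zero {k : ℕ} (hke : Even k) {x : V → ℝ} (hx : x ≠ 0) :
    0 < ∑ v, x v ^ k := by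
  obtain ⟨v, hv⟩ := Function.ne_iff.mp hx
  exact Finset.sum_pos' (fun w _ => hke.pow_nonneg _) ⟨v, Finset.mem_univ v, hke.pow_pos hv⟩

/-- The quotient of `edgeForm` by the sum of `k`-th powers attains its minimum. -/
lemma exists_edgeForm_minimizer [Nonempty V] {E : Finset (Finset V)} {k : ℕ} (hk : k ≠ 0)
    (hke : Even k) (hunif : ∀ e ∈ E, e.card = k) (c : V → ℝ) :
    ∃ (a : ℝ) (x : V → ℝ), x ≠ 0 ∧ edgeForm E k c x = a * ∑ v, x v ^ k ∧
      ∀ y : V → ℝ, a * ∑ v, y v ^ k ≤ edgeForm E k c y := by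
  have hne : ∀ x ∈ Metric.sphere (0 : V → ℝ) 1, x ≠ 0 := fun x hx =>
    ne_zero_of_mem_unit_sphere ⟨x, hx⟩
  have hcont : ContinuousOn (fun x : V → ℝ => edgeForm E k c x / ∑ v, x v ^ k)
      (Metric.sphere 0 1) := by
    refine ContinuousOn.div ?_ ?_ fun x hx => (sum_pow_pos_of_ne_zero hke (hne x hx)).ne'
    · unfold edgeForm
      fun_prop
    · fun_prop
  obtain ⟨x, hx, hmin⟩ := (isCompact_sphere (0 : V → ℝ) 1).exists_isMinOn
    (NormedSpace.sphere_nonempty.mpr zero_le_one) hcont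
  refine ⟨_, x, hne x hx,
    (div_mul_cancel₀ _ (sum_pow_pos_of_ne_zero hke (hne x hx)).ne').symm, fun y => ?_⟩
  rcases eq_or_ne y 0 with rfl | hy
  · have h := edgeForm_smul hunif c (0 : V → ℝ) 0
    simp only [smul_zero, zero_pow hk, zero_mul] at h
    simp [h, zero_pow hk]
  · have hs : ‖y‖⁻¹ ^ k ≠ 0 := pow_ne_zero _ (inv_ne_zero (norm_ne_zero_iff.mpr hy))
    have hmem : ‖y‖⁻¹ • y ∈ Metric.sphere (0 : V → ℝ) 1 := by
      rw [mem_sphere_zero_iff_norm, norm_smul, norm_inv, norm_norm,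
        inv_mul_cancel₀ (norm_ne_zero_iff.mpr hy)]
    have h := isMinOn_iff.mp hmin _ hmem
    simp only [edgeForm_smul hunif, Pi.smul_apply, smul_eq_mul, mul_pow, ← Finset.mul_sum]
      at h
    rw [mul_div_mul_left _ _ hs] at h
    exact (le_div_iff₀ (sum_pow_pos_of_ne_zero hke hy)).mp h

variable [DecidableEq V]

lemma hasDerivAt_edgeForm_update (E : Finset (Finset V)) (k : ℕ) (c x : V → ℝ) (v : V) :
    HasDerivAt (fun t => edgeForm E k c (Function.update x v t))
      (k * (c v * x v ^ (k - 1) + ∑ e ∈ E with v ∈ e, ∏ w ∈ e.erase v, x w)) (x v) := by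
  have hpow : ∀ w ∈ (univ : Finset V), HasDerivAt
      (fun t => c w * Function.update x v t w ^ k)
      (if w = v then c w * (k * x v ^ (k - 1)) else 0) (x v) := fun w _ => by
    split_ifs with h
    · subst h
      simpa using (hasDerivAt_pow k (x w)).const_mul (c w)
    · simpa [Function.update_of_ne h] using hasDerivAt_const (x v) (c w * x w ^ k)
  have hedge : ∀ e ∈ E, HasDerivAt (fun t => ∏ w ∈ e, Function.update x v t w)
      (if v ∈ e then ∏ w ∈ e.erase v, x w else 0) (x v) := fun e _ => by
    split_ifs with h
    · have heq : ∀ t, ∏ w ∈ e, Function.update x v t w = t * ∏ w ∈ e.erase v, x w :=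
        fun t => by rw [Finset.prod_update_of_mem h, Finset.sdiff_singleton_eq_erase]
      simp only [heq]
      simpa using (hasDerivAt_id (x v)).mul_const (∏ w ∈ e.erase v, x w)
    · simp only [Finset.prod_update_of_notMem h]
      exact hasDerivAt_const _ _
  refine ((HasDerivAt.fun_sum hpow).add
    ((HasDerivAt.fun_sum hedge).const_mul (k : ℝ))).congr_deriv ?_
  rw [Finset.sum_ite_eq' univ v, if_pos (Finset.mem_univ v), Finset.sum_filter]
  ring

/-- If `c` vanishes at a vertex of some edge, the form takes a negative value. -/
lemma exists_edgeForm_neg {E : Finset (Finset V)} {k : ℕ} (hk : 2 ≤ k) (hke : Even k)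
    (hunif : ∀ e ∈ E, e.card = k) {c : V → ℝ} (hc : ∀ v, 0 ≤ c v) {v : V} (hv : c v = 0)
    {e : Finset V} (he : e ∈ E) (hve : v ∈ e) : ∃ y : V → ℝ, edgeForm E k c y < 0 := by
  obtain ⟨u, hue, huv⟩ := Finset.exists_mem_ne (by rw [hunif e he]; lia) v
  have hC : 0 ≤ ∑ w, c w := Finset.sum_nonneg fun w _ => hc w
  set t : ℝ := (1 + ∑ w, c w)⁻¹ with ht
  have htpos : 0 < t := by positivity
  have htC : t * ∑ w, c w < 1 := by
    rw [ht, inv_mul_lt_iff₀ (by positivity)]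
    linarith
  let y : V → ℝ := fun w => if w = v then 1 else if w = u then -t else if w ∈ e then t else 0
  have hpow : ∑ w, c w * y w ^ k ≤ t ^ k * ∑ w, c w := by
    rw [Finset.mul_sum]
    refine Finset.sum_le_sum fun w _ => ?_
    rcases eq_or_ne w v with rfl | hw
    · simp [hv]
    · rw [mul_comm]
      refine mul_le_mul_of_nonneg_right ?_ (hc w)
      simp only [y, if_neg hw]
      split_ifs
      · rw [hke.neg_pow]
      · exact le_rfl
      · rw [zero_pow (by lia)]
        positivity
  have hprod : ∏ w ∈ e, y w = -t ^ (k - 1) := by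
    have hu : u ∈ e.erase v := Finset.mem_erase.mpr ⟨huv, hue⟩
    rw [← Finset.mul_prod_erase e y hve, ← Finset.mul_prod_erase _ y hu,
      Finset.prod_congr rfl (g := fun _ => t), Finset.prod_const, Finset.card_erase_of_mem hu,
      Finset.card_erase_of_mem hve, hunif e he]
    · obtain ⟨m, rfl⟩ := Nat.exists_eq_add_of_le' hk
      simp only [y, if_neg huv, if_true, Nat.add_sub_cancel, Nat.reduceSubDiff]
      ring
    · intro w hw
      simp only [Finset.mem_erase] at hw
      simp [y, hw]
  have hsum : ∑ f ∈ E, ∏ w ∈ f, y w = -t ^ (k - 1) := by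
    rw [← hprod]
    refine Finset.sum_eq_single_of_mem e he fun f hf hfe => ?_
    obtain ⟨w, hwf, hwe⟩ := Finset.not_subset.mp fun hsub =>
      hfe (Finset.eq_of_subset_of_card_le hsub (by rw [hunif e he, hunif f hf]))
    refine Finset.prod_eq_zero hwf ?_
    have hwv : w ≠ v := fun h => hwe (h ▸ hve)
    have hwu : w ≠ u := fun h => hwe (h ▸ hue)
    simp [y, hwv, hwu, hwe]
  refine ⟨y, ?_⟩
  have hk' : (2 : ℝ) ≤ k := by exact_mod_cast hk
  have hneg : t ^ (k - 1) * (t * ∑ w, c w - k) < 0 :=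
    mul_neg_of_pos_of_neg (by positivity) (by linarith)
  have htk : t ^ k = t ^ (k - 1) * t := (pow_sub_one_mul (by lia) t).symm
  rw [htk] at hpow
  rw [edgeForm, hsum]
  linarith

end SignlessLaplacianForm

open Finset

/-- a `k`-uniform hypergraph with `k ≥ 2` even, in which every vertex lies in at
least one edge, has a signless Laplacian H-eigenvalue `λ` with `λ < δ(H)`, the minimum
vertex degree. -/
theorem stmt4 {V : Type*} [Fintype V] [DecidableEq V] [Nonempty V]
    (k : ℕ) (hk : 2 ≤ k) (hke : Even k)
    (E : Finset (Finset V)) (hunif : ∀ e ∈ E, e.card = k)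
    (hcover : ∀ v : V, ∃ e ∈ E, v ∈ e) :
    ∃ (lam : ℝ) (x : V → ℝ), x ≠ 0 ∧
      (∀ v : V,
        lam * x v ^ (k - 1)
          = ((E.filter (fun e => v ∈ e)).card : ℝ) * x v ^ (k - 1)
            + ∑ e ∈ E.filter (fun e => v ∈ e), ∏ w ∈ e.erase v, x w) ∧
      lam < ((Finset.univ.inf' Finset.univ_nonempty
          (fun v : V => (E.filter (fun e => v ∈ e)).card) : ℕ) : ℝ) := by
  set d : V → ℕ := fun v => (E.filter (fun e => v ∈ e)).card
  obtain ⟨lam, x, hx, hval, hmin⟩ :=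
    exists_edgeForm_minimizer (by lia) hke hunif (fun v => (d v : ℝ))
  refine ⟨lam, x, hx, fun v => ?_, ?_⟩
  · have hloc : IsLocalMin (fun t => edgeForm E k (fun w => (d w : ℝ) - lam)
        (Function.update x v t)) (x v) := by
      refine Filter.Eventually.of_forall fun t => ?_
      simp only [Function.update_eq_self, edgeForm_sub_const, hval, sub_self]
      exact sub_nonneg.mpr (hmin _)
    have hzero := hloc.hasDerivAt_eq_zero (hasDerivAt_edgeForm_update E k _ x v)
    have hk0 : (k : ℝ) ≠ 0 := by
      exact_mod_cast (by lia : k ≠ 0)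
    have h := (mul_eq_zero.mp hzero).resolve_left hk0
    change _ = (d v : ℝ) * _ + _
    linarith
  · obtain ⟨v, -, hv⟩ := Finset.exists_mem_eq_inf' (Finset.univ_nonempty (α := V)) d
    obtain ⟨e, he, hve⟩ := hcover v
    have hle : ∀ w, d v ≤ d w := fun w => hv ▸ Finset.inf'_le d (Finset.mem_univ w)
    obtain ⟨y, hy⟩ := exists_edgeForm_neg hk hke hunif
      (c := fun w => (d w : ℝ) - d v)
      (fun w => sub_nonneg.mpr (by exact_mod_cast hle w)) (sub_self _) he hve
    rw [edgeForm_sub_const] at hy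
    rw [hv]
    have hN : 0 ≤ ∑ w, y w ^ k := Finset.sum_nonneg fun w _ => hke.pow_nonneg _
    exact lt_of_mul_lt_mul_right (by linarith [hmin y]) hN
end

section
/- For n ≥ 1, let C_{2n+1}+e denote the simple graph with vertex set {v_0, v_1, …, v_{2n+1}} and edge set {v_i v_{i+1} : 1 ≤ i ≤ 2n} ∪ {v_{2n+1} v_1} ∪ {v_0 v_1} (an odd cycle of length 2n+1 with a pendant edge attached at v_1). Let λ_min(n) denote the least eigenvalue of the adjacency matrix of C_{2n+1}+e. Then λ_min(n) → −√(2+√5) as n → ∞. -/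
open Finset

/-- The adjacency matrix of the graph `C_{2n+1} + e`: an odd cycle `v_1 v_2 ⋯ v_{2n+1} v_1`
together with a pendant edge `v_0 v_1`, on the vertex set `{v_0, v_1, …, v_{2n+1}}`
(identified with `Fin (2n+2)`). -/
def cneMatrix (n : ℕ) : Matrix (Fin (2 * n + 2)) (Fin (2 * n + 2)) ℝ :=
  Matrix.of fun i j =>
    if ((1 ≤ i.val ∧ i.val ≤ 2 * n ∧ j.val = i.val + 1)
          ∨ (i.val = 2 * n + 1 ∧ j.val = 1) ∨ (i.val = 0 ∧ j.val = 1))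
        ∨ ((1 ≤ j.val ∧ j.val ≤ 2 * n ∧ i.val = j.val + 1)
          ∨ (j.val = 2 * n + 1 ∧ i.val = 1) ∨ (j.val = 0 ∧ i.val = 1))
    then 1 else 0

/-- A number below all eigenvalues of a real symmetric matrix bounds its Rayleigh quotients
from below. -/
lemma Matrix.IsHermitian.mul_dotProduct_le {ι : Type*} [Fintype ι] [DecidableEq ι]
    {A : Matrix ι ι ℝ} (hA : A.IsHermitian) {c : ℝ}
    (hc : ∀ μ : ℝ, (∃ y : ι → ℝ, y ≠ 0 ∧ A.mulVec y = μ • y) → c ≤ μ) (x : ι → ℝ) :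
    c * (x ⬝ᵥ x) ≤ x ⬝ᵥ A.mulVec x := by
  have hB : (A - c • (1 : Matrix ι ι ℝ)).IsHermitian := by
    refine hA.sub ?_
    simp [Matrix.IsHermitian]
  have hpsd : (A - c • (1 : Matrix ι ι ℝ)).PosSemidef := by
    rw [hB.posSemidef_iff_eigenvalues_nonneg]
    intro i
    have hne : (hB.eigenvectorBasis i).ofLp ≠ 0 := by
      intro h0
      apply hB.eigenvectorBasis.orthonormal.ne_zero i
      ext j
      exact congrFun h0 j
    have hv := hB.mulVec_eigenvectorBasis i
    have := hc (hB.eigenvalues i + c) ⟨_, hne, by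
      rw [Matrix.sub_mulVec, Matrix.smul_mulVec, Matrix.one_mulVec] at hv
      rw [add_smul, ← hv, sub_add_cancel]⟩
    simpa using this
  have := hpsd.dotProduct_mulVec_nonneg x
  rw [Matrix.sub_mulVec, Matrix.smul_mulVec, Matrix.one_mulVec, dotProduct_sub,
    dotProduct_smul] at this
  simpa using this

/-- Collatz–Wielandt bound: a positive `w` with `A w ≤ r w` bounds all eigenvalues of the
nonnegative matrix `A`. -/
lemma Matrix.abs_eigenvalue_le_of_mulVec_le {ι : Type*} [Fintype ι]
    {A : Matrix ι ι ℝ} (hA : ∀ i j, 0 ≤ A i j) {w : ι → ℝ} (hw : ∀ i, 0 < w i) {r : ℝ}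
    (hr : ∀ i, A.mulVec w i ≤ r * w i) {μ : ℝ} {y : ι → ℝ} (hy : y ≠ 0)
    (hμ : A.mulVec y = μ • y) : |μ| ≤ r := by
  obtain ⟨k, hk⟩ := Function.ne_iff.mp hy
  obtain ⟨i, -, hi⟩ := Finset.exists_max_image univ (fun i => |y i| / w i) ⟨k, mem_univ k⟩
  have hpos : 0 < |y i| / w i :=
    (div_pos (abs_pos.mpr hk) (hw k)).trans_le (hi k (mem_univ k))
  have hle : |μ| * |y i| ≤ |y i| / w i * (r * w i) := by
    calc |μ| * |y i| = |A.mulVec y i| := by rw [hμ]; simp [abs_mul]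
      _ ≤ ∑ j, |A i j * y j| := Finset.abs_sum_le_sum_abs _ _
      _ ≤ ∑ j, |y i| / w i * (A i j * w j) := by
        refine Finset.sum_le_sum fun j _ => ?_
        have := (div_le_iff₀ (hw j)).mp (hi j (mem_univ j))
        rw [abs_mul, abs_of_nonneg (hA i j)]
        calc A i j * |y j| ≤ A i j * (|y i| / w i * w j) :=
              mul_le_mul_of_nonneg_left this (hA i j)
          _ = _ := by ring
      _ = |y i| / w i * A.mulVec w i := by
        rw [← Finset.mul_sum]; rfl
      _ ≤ _ := mul_le_mul_of_nonneg_left (hr i) hpos.le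
  have hyi : 0 < |y i| := by
    by_contra h0
    have : |y i| = 0 := le_antisymm (not_lt.mp h0) (abs_nonneg _)
    simp [this] at hpos
  have hwi := (hw i).ne'
  rw [show |y i| / w i * (r * w i) = r * |y i| by field_simp] at hle
  exact le_of_mul_le_mul_right hle hyi

lemma cneMatrix_isHermitian (n : ℕ) : (cneMatrix n).IsHermitian := by
  ext i j
  simp only [Matrix.conjTranspose_apply, cneMatrix, Matrix.of_apply, star_trivial]
  congr 1
  exact propext or_comm

lemma cneMatrix_nonneg (n : ℕ) (i j : Fin (2 * n + 2)) : 0 ≤ cneMatrix n i j := by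
  simp only [cneMatrix, Matrix.of_apply]
  split_ifs <;> norm_num

lemma cneMatrix_mulVec (n : ℕ) (hn : 1 ≤ n) (f : ℕ → ℝ) (i : Fin (2 * n + 2)) :
    (cneMatrix n).mulVec (fun j => f j) i =
      if i.val = 0 then f 1 else if i.val = 1 then f 0 + f 2 + f (2 * n + 1)
      else if i.val = 2 * n + 1 then f (2 * n) + f 1 else f (i.val - 1) + f (i.val + 1) := by
  have hi := i.isLt
  have hs : ∀ a, a < 2 * n + 2 →
      ∑ j ∈ range (2 * n + 2), (if j = a then f j else 0) = f a := by
    intro a ha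
    simp [Finset.sum_ite_eq', ha]
  have key : (cneMatrix n).mulVec (fun j => f j) i = ∑ j ∈ range (2 * n + 2),
      if ((1 ≤ i.val ∧ i.val ≤ 2 * n ∧ j = i.val + 1)
          ∨ (i.val = 2 * n + 1 ∧ j = 1) ∨ (i.val = 0 ∧ j = 1))
        ∨ ((1 ≤ j ∧ j ≤ 2 * n ∧ i.val = j + 1)
          ∨ (j = 2 * n + 1 ∧ i.val = 1) ∨ (j = 0 ∧ i.val = 1)) then f j else 0 := by
    rw [← Fin.sum_univ_eq_sum_range]
    simp only [Matrix.mulVec, dotProduct, cneMatrix, Matrix.of_apply, ite_mul, one_mul, zero_mul]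
  rw [key]
  split_ifs with h0 h1 h2
  · rw [← hs 1 (by omega)]
    exact Finset.sum_congr rfl fun j _ => if_congr (by omega) rfl rfl
  · rw [← hs 0 (by omega), ← hs 2 (by omega), ← hs (2 * n + 1) (by omega),
      ← Finset.sum_add_distrib, ← Finset.sum_add_distrib]
    refine Finset.sum_congr rfl fun j _ => ?_
    split_ifs <;> first | omega | simp
  · rw [← hs (2 * n) (by omega), ← hs 1 (by omega), ← Finset.sum_add_distrib]
    refine Finset.sum_congr rfl fun j _ => ?_
    split_ifs <;> first | omega | simp
  · rw [← hs (i.val - 1) (by omega), ← hs (i.val + 1) (by omega), ← Finset.sum_add_distrib]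
    refine Finset.sum_congr rfl fun j _ => ?_
    split_ifs <;> first | omega | simp

/-- A vector on the vertices of `C_{2n+1} + e` decaying geometrically with ratio `a` away
from `v_1`. -/
noncomputable def cneVec (n : ℕ) (a : ℝ) (k : ℕ) : ℝ :=
  if k = 0 then (1 + a ^ (2 * n + 1)) / (a + 1 / a) else a ^ (k - 1) + a ^ (2 * n + 2 - k)

lemma cneMatrix_mulVec_cneVec (n : ℕ) (hn : 1 ≤ n) {a : ℝ} (ha : a ≠ 0)
    (h4 : a ^ 4 + a ^ 2 = 1) (i : Fin (2 * n + 2)) :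
    (cneMatrix n).mulVec (fun j => cneVec n a j) i =
      (a + 1 / a) * cneVec n a i + if i.val = 1 then 2 * a ^ (2 * n) * (1 - a ^ 2) else 0 := by
  have hi := i.isLt
  have hθ : a + 1 / a = (a ^ 2 + 1) / a := by field_simp
  have hp : a ^ 2 + 1 ≠ 0 := by positivity
  have hθ0 : a + 1 / a ≠ 0 := by rw [hθ]; exact div_ne_zero hp ha
  have hinv : 1 / (a + 1 / a) = 1 / a - a := by
    rw [div_eq_iff hθ0]
    field_simp
    linear_combination h4
  rw [cneMatrix_mulVec n hn]
  have hv : ∀ k, k ≠ 0 → cneVec n a k = a ^ (k - 1) + a ^ (2 * n + 2 - k) :=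
    fun k hk => if_neg hk
  by_cases h0 : i.val = 0
  · simp [h0, cneVec]
    field_simp
  by_cases h1 : i.val = 1
  · rw [if_neg h0, if_pos h1, if_pos h1, h1, hv 1 one_ne_zero, hv 2 two_ne_zero,
      hv (2 * n + 1) (by omega), show 2 * n + 2 - 2 = 2 * n by omega,
      show 2 * n + 2 - (2 * n + 1) = 1 by omega, show 2 * n + 2 - 1 = 2 * n + 1 by omega]
    simp only [cneVec, if_true, Nat.add_sub_cancel, Nat.sub_self]
    rw [div_eq_mul_one_div, hinv]
    norm_num
    field_simp
    ring
  by_cases h2 : i.val = 2 * n + 1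
  · obtain ⟨m, rfl⟩ : ∃ m, n = m + 1 := ⟨n - 1, by omega⟩
    rw [if_neg h0, if_neg h1, if_pos h2, if_neg h1, h2, hv _ (by omega), hv 1 one_ne_zero,
      hv _ (by omega), show 2 * (m + 1) + 2 - 2 * (m + 1) = 2 by omega,
      show 2 * (m + 1) + 2 - (2 * (m + 1) + 1) = 1 by omega,
      show 2 * (m + 1) + 2 - 1 = 2 * m + 3 by omega,
      show 2 * (m + 1) - 1 = 2 * m + 1 by omega,
      show 2 * (m + 1) + 1 - 1 = 2 * m + 2 by omega]
    field_simp
    ring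
  · obtain ⟨m, hm⟩ : ∃ m, i.val = m + 2 := ⟨i.val - 2, by omega⟩
    obtain ⟨l, hl⟩ : ∃ l, 2 * n = m + 1 + l := ⟨2 * n - (m + 1), by omega⟩
    rw [if_neg h0, if_neg h1, if_neg h2, if_neg h1, hm, hv _ (by omega), hv _ (by omega),
      hv _ (by omega), show m + 2 - 1 - 1 = m by omega,
      show 2 * n + 2 - (m + 2 - 1) = l + 2 by omega,
      show m + 2 + 1 - 1 = m + 2 by omega, show 2 * n + 2 - (m + 2 + 1) = l by omega,
      show m + 2 - 1 = m + 1 by omega, show 2 * n + 2 - (m + 2) = l + 1 by omega]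
    field_simp
    ring

lemma cneMatrix_abs_eigenvalue_le (n : ℕ) (hn : 1 ≤ n) {p : ℝ} (hp : 0 < p)
    (h4 : p ^ 4 + p ^ 2 = 1) {μ : ℝ} {y : Fin (2 * n + 2) → ℝ} (hy : y ≠ 0)
    (hμ : (cneMatrix n).mulVec y = μ • y) : |μ| ≤ p + 1 / p + 2 * p ^ (2 * n) := by
  have hw : ∀ k, 0 < cneVec n p k := by
    intro k
    unfold cneVec
    split_ifs <;> positivity
  refine Matrix.abs_eigenvalue_le_of_mulVec_le (cneMatrix_nonneg n)
    (w := fun j => cneVec n p j) (fun i => hw i) (fun i => ?_) hy hμ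
  rw [cneMatrix_mulVec_cneVec n hn hp.ne' h4, add_mul _ (2 * p ^ (2 * n))]
  gcongr
  have hpn : 0 < p ^ (2 * n) := by positivity
  split_ifs with h1
  · have hw1 : 1 ≤ cneVec n p i := by
      have : 0 < p ^ (2 * n + 1) := by positivity
      simp only [h1, cneVec, one_ne_zero, if_false, Nat.sub_self, pow_zero]
      simpa using this.le
    nlinarith [mul_pos hpn (pow_pos hp 2), mul_le_mul_of_nonneg_left hw1 hpn.le]
  · have := hw i
    positivity

lemma cneMatrix_least_eigenvalue_le (n : ℕ) (hn : 1 ≤ n) {p : ℝ} (hp : 0 < p) (hp1 : p < 1)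
    (h4 : p ^ 4 + p ^ 2 = 1) {c : ℝ}
    (hc : ∀ μ : ℝ, (∃ y : Fin (2 * n + 2) → ℝ, y ≠ 0 ∧ (cneMatrix n).mulVec y = μ • y) →
      c ≤ μ) : c ≤ -(p + 1 / p) + 2 * p ^ (2 * n) / (1 - p) := by
  have hray := (cneMatrix_isHermitian n).mul_dotProduct_le hc (fun j => cneVec n (-p) j)
  set x : Fin (2 * n + 2) → ℝ := fun j => cneVec n (-p) j with hx
  have hpn : 0 < p ^ (2 * n) := by positivity
  have hpn1 : p ^ (2 * n) ≤ 1 := pow_le_one₀ hp.le hp1.le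
  let v : Fin (2 * n + 2) := ⟨1, by omega⟩
  have hxv : x v = 1 - p ^ (2 * n + 1) := by
    have : (-p) ^ (2 * n + 1) = -p ^ (2 * n + 1) := Odd.neg_pow ⟨n, rfl⟩ p
    simp [hx, v, cneVec, this, sub_eq_add_neg]
  have hxv1 : 1 - p ≤ x v := by
    rw [hxv, pow_succ]
    nlinarith
  have hmul : (cneMatrix n).mulVec x =
      (-(p + 1 / p)) • x + Pi.single (M := fun _ => ℝ) v (2 * p ^ (2 * n) * (1 - p ^ 2)) := by
    ext i
    rw [hx, cneMatrix_mulVec_cneVec n hn (neg_ne_zero.mpr hp.ne')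
      (by rw [Even.neg_pow ⟨2, rfl⟩, Even.neg_pow ⟨1, rfl⟩, h4])]
    have e : (-p) ^ (2 * n) = p ^ (2 * n) := Even.neg_pow ⟨n, by ring⟩ p
    have hiv : i = v ↔ i.val = 1 := Fin.ext_iff
    simp only [Pi.add_apply, Pi.smul_apply, smul_eq_mul, Pi.single_apply, hiv, e, neg_sq]
    congr 1
    rw [div_neg]
    ring
  rw [hmul, dotProduct_add, dotProduct_smul, dotProduct_single, smul_eq_mul] at hray
  have hnorm : x v * x v ≤ x ⬝ᵥ x :=
    Finset.single_le_sum (f := fun i : Fin (2 * n + 2) => x i * x i) (fun i _ => mul_self_nonneg _) (mem_univ v)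
  have hxpos : 0 < x v := by linarith
  by_contra! hlt
  have hpos : 0 < 2 * p ^ (2 * n) / (1 - p) := div_pos (by positivity) (by linarith)
  have hd : 0 < c + (p + 1 / p) := by linarith
  have h1 : (c + (p + 1 / p)) * (x v * x v) ≤ x v * (2 * p ^ (2 * n) * (1 - p ^ 2)) := by
    have := mul_le_mul_of_nonneg_left hnorm hd.le
    linarith
  have h2 : (c + (p + 1 / p)) * x v ≤ 2 * p ^ (2 * n) * (1 - p ^ 2) :=
    le_of_mul_le_mul_right (by linarith) hxpos
  have h3 : 2 * p ^ (2 * n) < (c + (p + 1 / p)) * (1 - p) := by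
    rw [← div_lt_iff₀ (by linarith)]
    linarith
  nlinarith [mul_le_mul_of_nonneg_left hxv1 hd.le, mul_pos hpn (pow_pos hp 2)]

/-- if `lam n` is the least eigenvalue of the adjacency matrix of
`C_{2n+1} + e` for every `n ≥ 1`, then `lam n → -√(2+√5)` as `n → ∞`. -/
theorem stmt18 (lam : ℕ → ℝ)
    (h : ∀ n : ℕ, 1 ≤ n →
      (∃ y : Fin (2 * n + 2) → ℝ, y ≠ 0 ∧ (cneMatrix n).mulVec y = lam n • y) ∧
      ∀ μ : ℝ, (∃ y : Fin (2 * n + 2) → ℝ, y ≠ 0 ∧ (cneMatrix n).mulVec y = μ • y) →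
        lam n ≤ μ) :
    Filter.Tendsto lam Filter.atTop (nhds (-Real.sqrt (2 + Real.sqrt 5))) := by
  have h5 : Real.sqrt 5 ^ 2 = 5 := Real.sq_sqrt (by norm_num)
  have h5l : 1 < Real.sqrt 5 := Real.lt_sqrt_of_sq_lt (by norm_num)
  have h5u : Real.sqrt 5 < 3 := (Real.sqrt_lt' (by norm_num)).mpr (by norm_num)
  obtain ⟨p, hp, hp2⟩ : ∃ p : ℝ, 0 < p ∧ p ^ 2 = (Real.sqrt 5 - 1) / 2 :=
    ⟨Real.sqrt ((Real.sqrt 5 - 1) / 2), Real.sqrt_pos.mpr (by linarith),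
      Real.sq_sqrt (by linarith)⟩
  have hp1 : p < 1 := by nlinarith
  have h4 : p ^ 4 + p ^ 2 = 1 := by
    rw [show p ^ 4 = (p ^ 2) ^ 2 by ring, hp2]
    linear_combination h5 / 4
  have hρ : Real.sqrt (2 + Real.sqrt 5) = p + 1 / p := by
    rw [Real.sqrt_eq_iff_mul_self_eq (by positivity) (by positivity)]
    have : 2 + Real.sqrt 5 = 2 * p ^ 2 + 3 := by rw [hp2]; ring
    rw [this]
    field_simp
    linear_combination h4
  rw [hρ]
  have hpow : Filter.Tendsto (fun n : ℕ => 2 * p ^ (2 * n)) Filter.atTop (nhds 0) := by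
    have := (tendsto_pow_atTop_nhds_zero_of_lt_one (sq_nonneg p)
      (by nlinarith : p ^ 2 < 1)).const_mul 2
    simpa [pow_mul] using this
  refine tendsto_of_tendsto_of_tendsto_of_le_of_le' (g := fun n => -(p + 1 / p) - 2 * p ^ (2 * n))
    (h := fun n => -(p + 1 / p) + 2 * p ^ (2 * n) / (1 - p)) ?_ ?_ ?_ ?_
  · simpa using hpow.const_sub (-(p + 1 / p))
  · simpa using (hpow.div_const (1 - p)).const_add (-(p + 1 / p))
  · filter_upwards [Filter.eventually_ge_atTop 1] with n hn
    obtain ⟨y, hy, hμ⟩ := (h n hn).1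
    have := neg_le_of_abs_le (cneMatrix_abs_eigenvalue_le n hn hp h4 hy hμ)
    linarith
  · filter_upwards [Filter.eventually_ge_atTop 1] with n hn
    exact cneMatrix_least_eigenvalue_le n hn hp hp1 h4 (h n hn).2
end
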